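/- Let β be a nonempty sum indecomposable permutation, i.e., β cannot be written as ρ⊕σ for nonempty permutations ρ and σ (so that Av(β) and Av(1⊖β) are sum closed and possess finite proper growth rates). Then gr(Av(1⊖β)) ≥ (1 + √gr(Av(β)))². -/

import Mathlib

open Filter Topology ENNReal

/-- A permutation of length `n`, in one-line notation `π 0, π 1, …, π (n-1)`. -/
abbrev Perm (n : ℕ) := Equiv.Perm (Fin n)

/-- `Pattern σ π` : the permutation `σ` is contained in `π`, i.e. some subsequence of `π`
is order isomorphic to `σ`. -/
def Pattern {k n : ℕ} (σ : Perm k) (π : Perm n) : Prop :=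
  ∃ f : Fin k ↪o Fin n, ∀ i j : Fin k, σ i < σ j ↔ π (f i) < π (f j)

/-- A permutation class: a set of permutations closed downwards under containment. -/
structure PermClass where
  mem : ∀ n, Set (Perm n)
  closed : ∀ {k n : ℕ} (σ : Perm k) (π : Perm n), π ∈ mem n → Pattern σ π → σ ∈ mem k

/-- The entries of `π` at the positions in `A` form a sequence order isomorphic
to a member of the family `F`. -/
def SubpermIn {n : ℕ} (π : Perm n) (A : Set (Fin n)) (F : ∀ m, Set (Perm m)) : Prop :=
  ∃ (m : ℕ) (σ : Perm m) (f : Fin m ↪o Fin n),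
    Set.range ⇑f = A ∧ (∀ i j : Fin m, σ i < σ j ↔ π (f i) < π (f j)) ∧ σ ∈ F m

/-- The merge `C ⊙ D`: permutations whose entries can be partitioned into a subsequence
order isomorphic to a member of `C` and one order isomorphic to a member of `D`. -/
def mergeSet (C D : ∀ m, Set (Perm m)) (n : ℕ) : Set (Perm n) :=
  {π | ∃ A : Set (Fin n), SubpermIn π A C ∧ SubpermIn π Aᶜ D}

/-- `|F_n| ^ (1/n)` as a real number. -/
noncomputable def growthSeq (F : ∀ m, Set (Perm m)) (n : ℕ) : ℝ :=
  ((F n).ncard : ℝ) ^ ((n : ℝ)⁻¹)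

/-- The family `F` has (finite) proper growth rate `g`. -/
def HasGrowth (F : ∀ m, Set (Perm m)) (g : ℝ) : Prop :=
  Tendsto (growthSeq F) atTop (𝓝 g)

/-- `|F_n| ^ (1/n)` in the extended nonnegative reals. -/
noncomputable def eGrowthSeq (F : ∀ m, Set (Perm m)) (n : ℕ) : ℝ≥0∞ :=
  ((F n).ncard : ℝ≥0∞) ^ ((n : ℝ)⁻¹)

/-- The upper growth rate `limsup |F_n|^(1/n)`. -/
noncomputable def ugr (F : ∀ m, Set (Perm m)) : ℝ≥0∞ := limsup (eGrowthSeq F) atTop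

/-- The lower growth rate `liminf |F_n|^(1/n)`. -/
noncomputable def lgr (F : ∀ m, Set (Perm m)) : ℝ≥0∞ := liminf (eGrowthSeq F) atTop

/-- The direct sum `π ⊕ σ` of two permutations. -/
def dsum {m n : ℕ} (π : Perm m) (σ : Perm n) : Perm (m + n) :=
  finSumFinEquiv.symm.trans ((Equiv.sumCongr π σ).trans finSumFinEquiv)

/-- The skew sum `π ⊖ σ` of two permutations. -/
def skewSum {m n : ℕ} (π : Perm m) (σ : Perm n) : Perm (m + n) :=
  finSumFinEquiv.symm.trans ((Equiv.sumCongr π σ).trans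
    (((Equiv.sumComm (Fin m) (Fin n)).trans finSumFinEquiv).trans (finCongr (Nat.add_comm n m))))

/-- A family of permutations is sum closed if it is closed under `⊕`. -/
def SumClosed (F : ∀ m, Set (Perm m)) : Prop :=
  ∀ {m n : ℕ} (π : Perm m) (σ : Perm n), π ∈ F m → σ ∈ F n → dsum π σ ∈ F (m + n)

/-- A family of permutations is skew closed if it is closed under `⊖`. -/
def SkewClosed (F : ∀ m, Set (Perm m)) : Prop :=
  ∀ {m n : ℕ} (π : Perm m) (σ : Perm n), π ∈ F m → σ ∈ F n → skewSum π σ ∈ F (m + n)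

/-- The class of an empty (blocked) grid cell: only the empty permutation. -/
def emptyCell : ∀ m, Set (Perm m) := fun m => {_π | m = 0}

/-- The set of positions of `π` lying in column `k` and row `ℓ` of the gridding
determined by the column divisions `c` and row divisions `r`. -/
def cellSet {n : ℕ} (π : Perm n) (c r : ℕ → ℕ) (k ℓ : ℕ) : Set (Fin n) :=
  {i | c k ≤ (i : ℕ) ∧ (i : ℕ) < c (k + 1) ∧ r ℓ ≤ (π i : ℕ) ∧ (π i : ℕ) < r (ℓ + 1)}

/-- The grid class of an (infinite) matrix `M` of families of permutations, where
`M k ℓ` is the cell in column `k`, row `ℓ` (Cartesian coordinates, indexed from 0). -/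
def gridSet (M : ℕ → ℕ → ∀ m, Set (Perm m)) (n : ℕ) : Set (Perm n) :=
  {π | ∃ c r : ℕ → ℕ, Monotone c ∧ Monotone r ∧ c 0 = 0 ∧ r 0 = 0 ∧
    (∀ k, c k ≤ n) ∧ (∀ ℓ, r ℓ ≤ n) ∧ (∃ k, c k = n) ∧ (∃ ℓ, r ℓ = n) ∧
    ∀ k ℓ, cellSet π c r k ℓ = ∅ ∨ SubpermIn π (cellSet π c r k ℓ) (M k ℓ)}

/-- The matrix of the infinite increasing `(C, D)` staircase: cell in column `i`, row `i`
is `C`, cell in column `i+1`, row `i` is `D`, all other cells empty. -/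
def incStairM (C D : ∀ m, Set (Perm m)) : ℕ → ℕ → ∀ m, Set (Perm m) :=
  fun k ℓ => if k = ℓ then C else if k = ℓ + 1 then D else emptyCell

/-- The decreasing permutation `k (k-1) ⋯ 2 1` of length `k`. -/
def delta (k : ℕ) : Perm k := ⟨Fin.rev, Fin.rev, Fin.rev_rev, Fin.rev_rev⟩

/-- The class of permutations avoiding the pattern `τ`. -/
def avSet {k : ℕ} (τ : Perm k) : ∀ n, Set (Perm n) := fun n => {π | ¬ Pattern τ π}

/-- The shape of an infinite `(C,D)` staircase: `pos j` is the (column, row) position of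
the `(j+1)`-st cell; odd-indexed steps share a row with their predecessor, even-indexed
steps share a column with their predecessor, and no other sharing of rows or columns occurs. -/
structure StaircaseData where
  pos : ℕ → ℕ × ℕ
  inj : Function.Injective pos
  rowEq : ∀ i, (pos (2 * i + 1)).2 = (pos (2 * i)).2
  colEq : ∀ i, (pos (2 * i + 2)).1 = (pos (2 * i + 1)).1
  rowOnly : ∀ j j', (pos j).2 = (pos j').2 → j / 2 = j' / 2
  colOnly : ∀ j j', (pos j).1 = (pos j').1 → (j + 1) / 2 = (j' + 1) / 2

open Classical in
/-- The matrix of the infinite `(C,D)` staircase with shape `S`: the odd-numbered cells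
(cells `1, 3, 5, …`, i.e. `pos 0, pos 2, …`) are `C`, the even-numbered cells are `D`. -/
noncomputable def StaircaseData.M (S : StaircaseData) (C D : ∀ m, Set (Perm m)) :
    ℕ → ℕ → ∀ m, Set (Perm m) :=
  fun k ℓ => if ∃ i, S.pos (2 * i) = (k, ℓ) then C
    else if ∃ i, S.pos (2 * i + 1) = (k, ℓ) then D else emptyCell

open Classical in
/-- The matrix of the `t`-step restriction of the staircase: only the first `2t` cells. -/
noncomputable def StaircaseData.Mstep (S : StaircaseData) (C D : ∀ m, Set (Perm m)) (t : ℕ) :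
    ℕ → ℕ → ∀ m, Set (Perm m) :=
  fun k ℓ => if ∃ i < t, S.pos (2 * i) = (k, ℓ) then C
    else if ∃ i < t, S.pos (2 * i + 1) = (k, ℓ) then D else emptyCell

/-- The permutation `1` of length one. -/
def one1 : Perm 1 := 1

/-- The 0-1 matrix `A`, given by its set of ones, contains the permutation matrix of `β`. -/
def MatContains {k : ℕ} (β : Perm k) (A : Finset (ℕ × ℕ)) : Prop :=
  ∃ x y : Fin k → ℕ, StrictMono x ∧ StrictMono y ∧ ∀ i, (x i, y (β i)) ∈ A

/-- The index of the `s × s` block containing a given position. -/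
def blockIndex (s : ℕ) (p : ℕ × ℕ) : ℕ × ℕ := (p.1 / s, p.2 / s)

/-- The set of columns met by the ones of `A` lying in the block `q`. -/
def blockColumns (s : ℕ) (A : Finset (ℕ × ℕ)) (q : ℕ × ℕ) : Finset ℕ :=
  (A.filter fun p => blockIndex s p = q).image Prod.fst

theorem MatContains.of_image_blockIndex {k s : ℕ} {β : Perm k} {A : Finset (ℕ × ℕ)}
    (h : MatContains β (A.image (blockIndex s))) : MatContains β A := by
  obtain ⟨x, y, hx, hy, hxy⟩ := h
  choose u hu hux using fun i => Finset.mem_image.1 (hxy i)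
  simp only [blockIndex, Prod.mk.injEq] at hux
  refine ⟨fun i => (u i).1, fun i => (u (β.symm i)).2, fun i j hij => ?_, fun i j hij => ?_, ?_⟩
  · refine lt_of_not_ge fun hle => ?_
    have := Nat.div_le_div_right (c := s) hle
    rw [(hux i).1, (hux j).1] at this
    exact absurd (hx hij) (not_lt.2 this)
  · refine lt_of_not_ge fun hle => ?_
    have := Nat.div_le_div_right (c := s) hle
    rw [(hux _).2, (hux _).2, Equiv.apply_symm_apply, Equiv.apply_symm_apply] at this
    exact absurd (hy hij) (not_lt.2 this)
  · intro i
    simpa using hu i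

theorem MatContains.of_image_swap {k : ℕ} {β : Perm k} {A : Finset (ℕ × ℕ)}
    (h : MatContains β.symm (A.image Prod.swap)) : MatContains β A := by
  obtain ⟨x, y, hx, hy, hxy⟩ := h
  refine ⟨y, x, hy, hx, fun i => ?_⟩
  obtain ⟨p, hp, hpe⟩ := Finset.mem_image.1 (hxy (β i))
  obtain ⟨p₁, p₂⟩ := p
  simp only [Prod.swap_prod_mk, Prod.mk.injEq, Equiv.symm_apply_apply] at hpe
  rwa [← hpe.1, ← hpe.2]

theorem blockColumns_subset {s : ℕ} (hs : 0 < s) (A : Finset (ℕ × ℕ)) (q : ℕ × ℕ) :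
    blockColumns s A q ⊆ Finset.Ico (q.1 * s) (q.1 * s + s) := by
  intro x hx
  obtain ⟨p, hp, rfl⟩ := Finset.mem_image.1 hx
  obtain ⟨-, rfl⟩ := Finset.mem_filter.1 hp
  rw [Finset.mem_Ico]
  exact ⟨Nat.div_mul_le_self _ _, Nat.lt_div_mul_add hs⟩

/-- `k` blocks in one column of blocks whose ones occupy the same `k` or more columns contain
every permutation matrix of size `k`. -/
theorem matContains_of_blockColumns_eq {k s : ℕ} (β : Perm k) {A : Finset (ℕ × ℕ)}
    {Q : Finset (ℕ × ℕ)} {j : ℕ} {S : Finset ℕ} (hQ : k ≤ Q.card) (hj : ∀ q ∈ Q, q.1 = j)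
    (hS : ∀ q ∈ Q, blockColumns s A q = S) (hk : k ≤ S.card) : MatContains β A := by
  have hR : k ≤ (Q.image Prod.snd).card := by
    rwa [Finset.card_image_of_injOn]
    intro q hq q' hq' h
    exact Prod.ext ((hj q hq).trans (hj q' hq').symm) h
  obtain ⟨R, hRs, hRc⟩ := Finset.exists_subset_card_eq hR
  obtain ⟨S', hSs, hSc⟩ := Finset.exists_subset_card_eq hk
  have key : ∀ i : Fin k, ∃ v, (S'.orderEmbOfFin hSc i, v) ∈ A ∧
      v / s = R.orderEmbOfFin hRc (β i) := by
    intro i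
    obtain ⟨q, hq, hqe⟩ := Finset.mem_image.1 (hRs (R.orderEmbOfFin_mem hRc (β i)))
    have hmem := hSs (S'.orderEmbOfFin_mem hSc i)
    rw [← hS q hq] at hmem
    obtain ⟨p, hp, hpe⟩ := Finset.mem_image.1 hmem
    obtain ⟨hpA, hpq⟩ := Finset.mem_filter.1 hp
    refine ⟨p.2, ?_, ?_⟩
    · rwa [← hpe]
    · rw [← hqe, ← hpq, blockIndex]
  choose v hvA hv using key
  refine ⟨S'.orderEmbOfFin hSc, fun i => v (β.symm i), OrderEmbedding.strictMono _,
    fun a c hac => ?_, fun i => by simpa using hvA i⟩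
  refine lt_of_not_ge fun hle => ?_
  have := Nat.div_le_div_right (c := s) hle
  rw [hv, hv, Equiv.apply_symm_apply, Equiv.apply_symm_apply] at this
  exact absurd hac (not_lt.2 ((R.orderEmbOfFin hRc).le_iff_le.1 this))

theorem card_wide_blocks_le {k s N : ℕ} (hs : 0 < s) (β : Perm k) {A : Finset (ℕ × ℕ)}
    (hA : ¬ MatContains β A) {B : Finset (ℕ × ℕ)} (hB : ∀ q ∈ B, q.1 < N) :
    (B.filter fun q => k ≤ (blockColumns s A q).card).card ≤ k * 2 ^ s * N := by
  have hcol : ∀ j, ((B.filter fun q => k ≤ (blockColumns s A q).card).filter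
      fun q => q.1 = j).card ≤ k * 2 ^ s := by
    intro j
    have hcard : (Finset.Ico (j * s) (j * s + s)).powerset.card = 2 ^ s := by simp
    rw [← hcard]
    refine Finset.card_le_mul_card_image_of_maps_to (f := blockColumns s A) ?_ _ ?_
    · intro q hq
      rw [Finset.mem_powerset, ← (Finset.mem_filter.1 hq).2]
      exact blockColumns_subset hs A q
    · intro S _
      refine le_of_not_gt fun hlt => hA ?_
      obtain ⟨q, hq⟩ := Finset.card_pos.1 (Nat.zero_lt_of_lt hlt)
      refine matContains_of_blockColumns_eq (s := s) (S := S) (j := j) β hlt.le ?_ ?_ ?_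
      · intro q hq
        simp only [Finset.mem_filter] at hq
        exact hq.1.2
      · intro q hq
        simp only [Finset.mem_filter] at hq
        exact hq.2
      · simp only [Finset.mem_filter] at hq
        rw [← hq.2]
        exact hq.1.1.2
  have := Finset.card_le_mul_card_image_of_maps_to
      (s := B.filter fun q => k ≤ (blockColumns s A q).card)
    (t := Finset.range N) (f := Prod.fst)
    (fun q hq => Finset.mem_range.2 (hB q (Finset.mem_filter.1 hq).1)) _ (fun j _ => hcol j)
  simpa using this

theorem card_block_le (s : ℕ) (A : Finset (ℕ × ℕ)) (q : ℕ × ℕ) :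
    (A.filter fun p => blockIndex s p = q).card ≤
      (blockColumns s A q).card * (blockColumns s (A.image Prod.swap) q.swap).card := by
  rw [← Finset.card_product]
  refine Finset.card_le_card fun p hp => Finset.mem_product.2 ⟨Finset.mem_image_of_mem _ hp, ?_⟩
  obtain ⟨hpA, hpq⟩ := Finset.mem_filter.1 hp
  refine Finset.mem_image.2 ⟨p.swap, Finset.mem_filter.2 ⟨Finset.mem_image_of_mem _ hpA, ?_⟩, rfl⟩
  rw [← hpq]
  rfl

theorem card_blockColumns_le {s : ℕ} (hs : 0 < s) (A : Finset (ℕ × ℕ)) (q : ℕ × ℕ) :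
    (blockColumns s A q).card ≤ s := by
  simpa using Finset.card_le_card (blockColumns_subset hs A q)

/-- The constant in the Marcus-Tardos bound for patterns of length `k`. -/
def marcusTardosConst (k : ℕ) : ℕ := 2 * (k * 2 ^ (k ^ 2)) * (k ^ 2) ^ 2

theorem image_blockIndex_subset {s t : ℕ} {A : Finset (ℕ × ℕ)}
    (hA : A ⊆ Finset.range (s ^ (t + 1)) ×ˢ Finset.range (s ^ (t + 1))) :
    A.image (blockIndex s) ⊆ Finset.range (s ^ t) ×ˢ Finset.range (s ^ t) := by
  intro q hq
  obtain ⟨p, hp, rfl⟩ := Finset.mem_image.1 hq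
  have := hA hp
  simp only [Finset.mem_product, Finset.mem_range, pow_succ, blockIndex] at this ⊢
  exact ⟨Nat.div_lt_of_lt_mul (by linarith [this.1]), Nat.div_lt_of_lt_mul (by linarith [this.2])⟩

/-- The **Marcus-Tardos theorem** for matrices whose side is a power of `k ^ 2`. -/
theorem marcusTardos {k : ℕ} (hk : 0 < k) (β : Perm k) (t : ℕ) {A : Finset (ℕ × ℕ)}
    (hA : A ⊆ Finset.range ((k ^ 2) ^ t) ×ˢ Finset.range ((k ^ 2) ^ t))
    (hav : ¬ MatContains β A) : A.card ≤ marcusTardosConst k * (k ^ 2) ^ t := by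
  induction t generalizing A with
  | zero =>
    have h1 := Finset.card_le_card hA
    have h2 : 0 < marcusTardosConst k := by unfold marcusTardosConst; positivity
    simp at h1 ⊢
    omega
  | succ t ih =>
    have hs : 0 < k ^ 2 := by positivity
    have hBs := image_blockIndex_subset hA
    have hBc := ih hBs fun h => hav h.of_image_blockIndex
    set s := k ^ 2 with hsdef
    set B := A.image (blockIndex s) with hB
    set C := A.image Prod.swap with hC
    have hwide := card_wide_blocks_le hs β hav (B := B) (N := s ^ t)
      fun q hq => Finset.mem_range.1 (Finset.mem_product.1 (hBs hq)).1
    have htall := card_wide_blocks_le hs β.symm (A := C)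
      (fun h => hav h.of_image_swap) (B := B.image Prod.swap) (N := s ^ t) (by
        intro q hq
        obtain ⟨p, hp, rfl⟩ := Finset.mem_image.1 hq
        exact Finset.mem_range.1 (Finset.mem_product.1 (hBs hp)).2)
    have htall' : (B.filter fun q => k ≤ (blockColumns s C q.swap).card).card
        ≤ k * 2 ^ s * s ^ t := by
      refine le_trans (Finset.card_le_card_of_injOn Prod.swap ?_
        Prod.swap_injective.injOn) htall
      intro q hq
      simp only [Finset.coe_filter, Set.mem_ofPred_eq, Finset.mem_image] at hq ⊢
      exact ⟨⟨q, hq.1, rfl⟩, hq.2⟩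
    have hsum : A.card = ∑ q ∈ B, (A.filter fun p => blockIndex s p = q).card :=
      Finset.card_eq_sum_card_fiberwise fun p hp => Finset.mem_image_of_mem _ hp
    have hterm : ∀ q ∈ B, (A.filter fun p => blockIndex s p = q).card ≤
        (if k ≤ (blockColumns s A q).card then s ^ 2 else 0) +
        (if k ≤ (blockColumns s C q.swap).card then s ^ 2 else 0) + (k - 1) ^ 2 := by
      intro q _
      have h := card_block_le s A q
      have h1 := card_blockColumns_le hs A q
      have h2 := card_blockColumns_le hs C q.swap
      have h3 := Nat.mul_le_mul h1 h2
      rw [← sq] at h3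
      split_ifs with hw ht ht
      · exact (h.trans h3).trans (by omega)
      · exact (h.trans h3).trans (by omega)
      · exact (h.trans h3).trans (by omega)
      · have h4 := Nat.mul_le_mul (Nat.le_sub_one_of_lt (not_le.1 hw))
          (Nat.le_sub_one_of_lt (not_le.1 ht))
        rw [← sq] at h4
        exact (h.trans h4).trans (by omega)
    have htotal := hsum.le.trans (Finset.sum_le_sum hterm)
    rw [Finset.sum_add_distrib, Finset.sum_add_distrib, ← Finset.sum_filter, ← Finset.sum_filter,
      Finset.sum_const, Finset.sum_const, Finset.sum_const, smul_eq_mul, smul_eq_mul,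
      smul_eq_mul] at htotal
    have hc : marcusTardosConst k = 2 * (k * 2 ^ s) * s ^ 2 := rfl
    have hk1 : (k - 1) ^ 2 + 1 ≤ s := by
      obtain ⟨r, rfl⟩ := Nat.exists_eq_succ_of_ne_zero hk.ne'
      simp only [Nat.succ_eq_add_one, Nat.add_sub_cancel, hsdef]
      nlinarith
    calc A.card ≤ _ := htotal
      _ ≤ k * 2 ^ s * s ^ t * s ^ 2 + k * 2 ^ s * s ^ t * s ^ 2
          + marcusTardosConst k * s ^ t * (k - 1) ^ 2 := by gcongr
      _ = marcusTardosConst k * s ^ t * ((k - 1) ^ 2 + 1) := by rw [hc]; ring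
      _ ≤ marcusTardosConst k * s ^ t * s := by gcongr
      _ = marcusTardosConst k * s ^ (t + 1) := by ring

open Classical in
/-- The 0-1 matrices of side `n` avoiding `β`. -/
noncomputable def avoidingMatrices {k : ℕ} (β : Perm k) (n : ℕ) : Finset (Finset (ℕ × ℕ)) :=
  (Finset.range n ×ˢ Finset.range n).powerset.filter fun A => ¬ MatContains β A

/-- Klazar's bound on the number of matrices avoiding a permutation matrix. -/
theorem card_avoidingMatrices_le {k : ℕ} (hk : 2 ≤ k) (β : Perm k) (t : ℕ) :
    (avoidingMatrices β ((k ^ 2) ^ t)).card ≤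
      2 ^ ((k ^ 2) ^ 2 * marcusTardosConst k * (k ^ 2) ^ t) := by
  classical
  have hs : 0 < k ^ 2 := by positivity
  have hcpos : 0 < marcusTardosConst k := by unfold marcusTardosConst; positivity
  induction t with
  | zero =>
    have h1 : (avoidingMatrices β ((k ^ 2) ^ 0)).card ≤ 2 ^ 1 := by
      refine (Finset.card_filter_le _ _).trans ?_
      simp
    refine h1.trans (Nat.pow_le_pow_right (by norm_num) ?_)
    exact Nat.succ_le_of_lt (by positivity)
  | succ t ih =>
    set s := k ^ 2 with hsdef
    set K := s ^ 2 * marcusTardosConst k with hK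
    have hs2 : 2 ≤ s := by nlinarith
    have hfib := Finset.card_le_mul_card_image_of_maps_to (s := avoidingMatrices β (s ^ (t + 1)))
      (t := avoidingMatrices β (s ^ t)) (f := fun A => A.image (blockIndex s)) (by
        intro A hA
        simp only [avoidingMatrices, Finset.mem_filter, Finset.mem_powerset] at hA ⊢
        exact ⟨image_blockIndex_subset hA.1, fun h => hA.2 h.of_image_blockIndex⟩)
      (2 ^ (K * s ^ t)) (by
        intro B hB
        simp only [avoidingMatrices, Finset.mem_filter, Finset.mem_powerset] at hB
        have hBc := marcusTardos (by omega) β t hB.1 hB.2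
        set U : Finset (ℕ × ℕ) := B.biUnion fun q =>
          Finset.Ico (q.1 * s) (q.1 * s + s) ×ˢ Finset.Ico (q.2 * s) (q.2 * s + s) with hU
        have hUc : U.card ≤ K * s ^ t := by
          have h1 : U.card ≤ B.card * (s * s) :=
            Finset.card_biUnion_le_card_mul _ _ _ fun q _ => by simp
          calc U.card ≤ B.card * (s * s) := h1
            _ ≤ marcusTardosConst k * s ^ t * (s * s) := by gcongr
            _ = K * s ^ t := by rw [hK]; ring
        refine le_trans (Finset.card_le_card (t := U.powerset) ?_)
          ((Finset.card_powerset U).le.trans (Nat.pow_le_pow_right (by norm_num) hUc))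
        intro A hA
        have hAB := (Finset.mem_filter.1 hA).2
        rw [Finset.mem_powerset]
        intro p hp
        rw [hU, Finset.mem_biUnion]
        refine ⟨blockIndex s p, ?_, ?_⟩
        · rw [← hAB]
          exact Finset.mem_image_of_mem _ hp
        · simp only [Finset.mem_product, Finset.mem_Ico, blockIndex]
          exact ⟨⟨Nat.div_mul_le_self _ _, Nat.lt_div_mul_add hs⟩,
            Nat.div_mul_le_self _ _, Nat.lt_div_mul_add hs⟩)
    calc _ ≤ _ := hfib
      _ ≤ 2 ^ (K * s ^ t) * 2 ^ (K * s ^ t) := by gcongr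
      _ = 2 ^ (K * s ^ t * 2) := by rw [← pow_add]; congr 1; ring
      _ ≤ 2 ^ (K * s ^ (t + 1)) := by
        refine Nat.pow_le_pow_right (by norm_num) ?_
        rw [pow_succ, ← mul_assoc]
        gcongr

/-- The matrix of a permutation. -/
def permMatrix {n : ℕ} (π : Perm n) : Finset (ℕ × ℕ) :=
  Finset.univ.image fun i : Fin n => ((i : ℕ), (π i : ℕ))

theorem permMatrix_injective (n : ℕ) : Function.Injective (permMatrix (n := n)) := by
  intro π σ h
  ext i
  have : ((i : ℕ), (π i : ℕ)) ∈ permMatrix σ := h ▸ Finset.mem_image_of_mem _ (Finset.mem_univ i)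
  obtain ⟨j, -, hj⟩ := Finset.mem_image.1 this
  simp only [Prod.mk.injEq, Fin.val_inj] at hj
  rw [← hj.2, hj.1]

theorem pattern_of_strictMono {k n : ℕ} {σ : Perm k} {π : Perm n} (f : Fin k → Fin n)
    (hf : StrictMono f) (h : ∀ i j, σ i < σ j ↔ π (f i) < π (f j)) : Pattern σ π :=
  ⟨OrderEmbedding.ofStrictMono f hf, h⟩

theorem pattern_of_matContains {k n : ℕ} {β : Perm k} {π : Perm n}
    (h : MatContains β (permMatrix π)) : Pattern β π := by
  obtain ⟨x, y, hx, hy, hxy⟩ := h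
  choose f _ hf using fun i => Finset.mem_image.1 (hxy i)
  simp only [Prod.mk.injEq] at hf
  refine pattern_of_strictMono f (fun i j hij => ?_) fun i j => ?_
  · rw [Fin.lt_def, (hf i).1, (hf j).1]
    exact hx hij
  · rw [Fin.lt_def (a := π _), (hf i).2, (hf j).2, hy.lt_iff_lt]

/-- The **Stanley-Wilf conjecture**: the number of permutations avoiding `β` grows at most
exponentially. -/
theorem exists_ncard_avSet_le_pow {k : ℕ} (hk : 2 ≤ k) (β : Perm k) :
    ∃ c : ℕ, ∀ n, (avSet β n).ncard ≤ c ^ n := by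
  set s := k ^ 2 with hsdef
  have hs2 : 1 < s := by nlinarith
  set K := s ^ 2 * marcusTardosConst k with hK
  refine ⟨2 ^ (K * s), fun n => ?_⟩
  obtain rfl | hn := Nat.eq_zero_or_pos n
  · refine (Set.ncard_le_card _).trans ?_
    simp [Nat.card_eq_fintype_card]
  obtain ⟨t, ht⟩ : ∃ t, n ≤ s ^ t ∧ s ^ t ≤ s * n := by
    refine ⟨Nat.clog s n, Nat.le_pow_clog hs2 n, ?_⟩
    obtain h1 | h1 := Nat.lt_or_ge 1 n
    · have := Nat.pow_pred_clog_lt_self hs2 h1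
      have hpos := Nat.clog_pos hs2 h1
      obtain ⟨r, hr⟩ := Nat.exists_eq_succ_of_ne_zero hpos.ne'
      rw [hr] at this ⊢
      simp only [Nat.succ_eq_add_one, Nat.pred_succ] at this ⊢
      rw [pow_succ, mul_comm]
      gcongr
    · rw [Nat.clog_of_right_le_one h1]
      simpa using Nat.succ_le_of_lt (Nat.mul_pos (by omega : 0 < s) hn)
  have hle : (avSet β n).ncard ≤ (avoidingMatrices β (s ^ t)).card := by
    rw [← Set.ncard_coe_finset]
    refine Set.ncard_le_ncard_of_injOn permMatrix ?_ (permMatrix_injective n).injOn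
      (Finset.finite_toSet _)
    intro π hπ
    simp only [avoidingMatrices, Finset.coe_filter, Finset.mem_powerset, Set.mem_ofPred_eq]
    refine ⟨fun p hp => ?_, fun h => hπ (pattern_of_matContains h)⟩
    obtain ⟨i, -, rfl⟩ := Finset.mem_image.1 hp
    simp only [Finset.mem_product, Finset.mem_range]
    exact ⟨i.2.trans_le ht.1, (π i).2.trans_le ht.1⟩
  calc _ ≤ _ := hle
    _ ≤ 2 ^ (K * s ^ t) := card_avoidingMatrices_le hk β t
    _ ≤ 2 ^ (K * (s * n)) := Nat.pow_le_pow_right (by norm_num) (Nat.mul_le_mul_left _ ht.2)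
    _ = (2 ^ (K * s)) ^ n := by rw [← pow_mul, mul_assoc K]

/-- A permutation is sum indecomposable if no proper nonempty prefix occupies the smallest
values. -/
def SumIndecomposable {b : ℕ} (β : Perm b) : Prop :=
  ∀ p, 0 < p → p < b → ¬ (∀ i : Fin b, (i : ℕ) < p ↔ (β i : ℕ) < p)

open Classical in
theorem lt_card_filter_iff {b : ℕ} {S : Fin b → Prop} (hS : ∀ i j, S i → ¬ S j → i < j)
    (i : Fin b) : (i : ℕ) < (Finset.univ.filter S).card ↔ S i := by
  constructor
  · intro h
    by_contra hi
    have : Finset.univ.filter S ⊆ Finset.Iio i := fun j hj =>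
      Finset.mem_Iio.2 (hS j i (Finset.mem_filter.1 hj).2 hi)
    have := Finset.card_le_card this
    rw [Fin.card_Iio] at this
    omega
  · intro h
    have : Finset.Iic i ⊆ Finset.univ.filter S := fun j hj =>
      Finset.mem_filter.2 ⟨Finset.mem_univ _, by_contra fun hj' =>
        absurd (hS i j h hj') (not_lt.2 (Finset.mem_Iic.1 hj))⟩
    have := Finset.card_le_card this
    rw [Fin.card_Iic] at this
    omega

theorem SumIndecomposable.forall_or_forall_not {b : ℕ} {β : Perm b} (h : SumIndecomposable β)
    {S : Fin b → Prop} (hS : ∀ i j, S i → ¬ S j → i < j ∧ β i < β j) :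
    (∀ i, S i) ∨ ∀ i, ¬ S i := by
  classical
  by_contra hcon
  push Not at hcon
  obtain ⟨⟨i, hi⟩, j, hj⟩ := hcon
  have h1 := lt_card_filter_iff (S := S) fun i j hi hj => (hS i j hi hj).1
  have h2 := lt_card_filter_iff (S := fun i => S (β.symm i)) fun i j hi hj => by
    simpa using (hS _ _ hi hj).2
  have hcard : (Finset.univ.filter fun i => S (β.symm i)).card = (Finset.univ.filter S).card :=
    Finset.card_bijective β.symm β.symm.bijective (by simp)
  refine h (Finset.univ.filter S).card ?_ ?_ fun i => ?_
  · exact (Nat.zero_le _).trans_lt ((h1 j).2 hj)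
  · by_contra hb
    exact hi ((h1 i).1 (i.2.trans_le (not_lt.1 hb)))
  · rw [h1, ← hcard, h2, Equiv.symm_apply_apply]

theorem finSumFinEquiv_inl_lt_inl {m n : ℕ} {i j : Fin m} :
    (finSumFinEquiv (Sum.inl i) : Fin (m + n)) < finSumFinEquiv (Sum.inl j) ↔ i < j :=
  Iff.rfl

theorem finSumFinEquiv_inr_lt_inr {m n : ℕ} {i j : Fin n} :
    (finSumFinEquiv (Sum.inr i) : Fin (m + n)) < finSumFinEquiv (Sum.inr j) ↔ i < j := by
  simp

theorem finSumFinEquiv_inl_lt_inr {m n : ℕ} (i : Fin m) (j : Fin n) :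
    (finSumFinEquiv (Sum.inl i) : Fin (m + n)) < finSumFinEquiv (Sum.inr j) := by
  simp only [finSumFinEquiv_apply_left, finSumFinEquiv_apply_right, Fin.lt_def, Fin.val_castAdd,
    Fin.val_natAdd]
  omega

theorem dsum_apply {m n : ℕ} (π : Perm m) (σ : Perm n) (q : Fin m ⊕ Fin n) :
    dsum π σ (finSumFinEquiv q) = finSumFinEquiv (Sum.map π σ q) := by
  simp [dsum]

theorem SumIndecomposable.sumClosed_avSet {b : ℕ} {β : Perm b} (h : SumIndecomposable β) :
    SumClosed (avSet β) := by
  rintro m n π σ hπ hσ ⟨f, hf⟩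
  obtain ⟨q, hq⟩ : ∃ q : Fin b → Fin m ⊕ Fin n, ∀ i, f i = finSumFinEquiv (q i) :=
    ⟨fun i => finSumFinEquiv.symm (f i), by simp⟩
  have hmono : ∀ i j, i < j ↔
      (finSumFinEquiv (q i) : Fin (m + n)) < finSumFinEquiv (q j) := by
    intro i j
    rw [← hq, ← hq, f.lt_iff_lt]
  simp only [hq, dsum_apply] at hf
  rcases h.forall_or_forall_not (S := fun i => (q i).isLeft) (by
    intro i j hi hj
    rw [hmono, hf]
    cases hqi : q i <;> cases hqj : q j <;> simp_all [finSumFinEquiv_inl_lt_inr,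
      -finSumFinEquiv_apply_left, -finSumFinEquiv_apply_right]) with hl | hr
  · choose u hu using fun i => Sum.isLeft_iff.1 (hl i)
    refine hπ (pattern_of_strictMono u (fun i j hij => ?_) fun i j => ?_)
    · rwa [hmono, hu, hu, finSumFinEquiv_inl_lt_inl] at hij
    · rw [hf, hu, hu, Sum.map_inl, Sum.map_inl, finSumFinEquiv_inl_lt_inl]
  · simp only [Sum.not_isLeft] at hr
    choose u hu using fun i => Sum.isRight_iff.1 (hr i)
    refine hσ (pattern_of_strictMono u (fun i j hij => ?_) fun i j => ?_)
    · rwa [hmono, hu, hu, finSumFinEquiv_inr_lt_inr] at hij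
    · rw [hf, hu, hu, Sum.map_inr, Sum.map_inr, finSumFinEquiv_inr_lt_inr]

theorem dsum_injective (m n : ℕ) :
    Function.Injective fun p : Perm m × Perm n => dsum p.1 p.2 := by
  rintro ⟨π, σ⟩ ⟨π', σ'⟩ h
  have key : ∀ q, Sum.map π σ q = Sum.map π' σ' q := fun q => by
    have := dsum_apply π σ q
    rw [show dsum π σ = dsum π' σ' from h, dsum_apply] at this
    exact (finSumFinEquiv.injective this).symm
  refine Prod.ext (Equiv.ext fun i => ?_) (Equiv.ext fun i => ?_)
  · simpa using key (Sum.inl i)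
  · simpa using key (Sum.inr i)

theorem SumClosed.ncard_mul_ncard_le {F : ∀ m, Set (Perm m)} (hF : SumClosed F) (m n : ℕ) :
    (F m).ncard * (F n).ncard ≤ (F (m + n)).ncard := by
  rw [← Set.ncard_prod]
  exact Set.ncard_le_ncard_of_injOn (fun p : Perm m × Perm n => dsum p.1 p.2)
    (fun p hp => hF _ _ hp.1 hp.2) (dsum_injective m n).injOn (Set.toFinite _)

theorem SumIndecomposable.one_mem_avSet {b : ℕ} (hb : 2 ≤ b) {β : Perm b}
    (h : SumIndecomposable β) (n : ℕ) : (1 : Perm n) ∈ avSet β n := by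
  rintro ⟨f, hf⟩
  have hβ : ∀ i j, β i < β j ↔ i < j := fun i j => by simpa using hf i j
  rcases h.forall_or_forall_not (S := fun i => (i : ℕ) = 0) (by
    intro i j hi hj
    rw [hβ, Fin.lt_def]
    omega) with h0 | h0
  · simpa using h0 ⟨1, hb⟩
  · exact h0 ⟨0, by omega⟩ rfl

/-- **Fekete's lemma** for sum closed families of permutations. -/
theorem SumClosed.exists_hasGrowth {F : ∀ m, Set (Perm m)} (hF : SumClosed F)
    (hpos : ∀ n, 0 < (F n).ncard) {c : ℕ} (hle : ∀ n, (F n).ncard ≤ c ^ n) :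
    ∃ g : ℝ, 1 ≤ g ∧ HasGrowth F g ∧ ∀ n, ((F n).ncard : ℝ) ≤ g ^ n := by
  have hpos' : ∀ n, (0 : ℝ) < (F n).ncard := fun n => by exact_mod_cast hpos n
  have hsub : Subadditive fun n => -Real.log (F n).ncard := by
    intro m n
    have h1 : ((F m).ncard : ℝ) * (F n).ncard ≤ (F (m + n)).ncard := by
      exact_mod_cast hF.ncard_mul_ncard_le m n
    have h2 := Real.log_le_log (mul_pos (hpos' m) (hpos' n)) h1
    rw [Real.log_mul (hpos' m).ne' (hpos' n).ne'] at h2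
    simp only
    linarith
  have hbdd : BddBelow (Set.range fun n : ℕ => -Real.log (F n).ncard / n) := by
    refine ⟨-Real.log c, ?_⟩
    rintro _ ⟨n, rfl⟩
    obtain rfl | hn := Nat.eq_zero_or_pos n
    · simpa using Real.log_natCast_nonneg c
    · have hn' : (0 : ℝ) < n := by exact_mod_cast hn
      simp only
      rw [le_div_iff₀ hn', neg_mul, neg_le_neg_iff, mul_comm, ← Real.log_pow]
      exact Real.log_le_log (hpos' n) (by exact_mod_cast hle n)
  have hlim := hsub.tendsto_lim hbdd
  have hnonneg : ∀ n, 0 ≤ Real.log (F n).ncard := fun n => Real.log_natCast_nonneg _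
  refine ⟨Real.exp (-hsub.lim), ?_, ?_, fun n => ?_⟩
  · have : hsub.lim ≤ 0 := le_of_tendsto' hlim fun n =>
      div_nonpos_of_nonpos_of_nonneg (by linarith [hnonneg n]) (Nat.cast_nonneg n)
    exact Real.one_le_exp (by linarith)
  · refine ((Real.continuous_exp.tendsto _).comp hlim.neg).congr fun n => ?_
    rw [growthSeq, Real.rpow_def_of_pos (hpos' n), Function.comp_apply]
    congr 1
    ring
  · obtain rfl | hn := Nat.eq_zero_or_pos n
    · simpa using hle 0
    · have hn' : (0 : ℝ) < n := by exact_mod_cast hn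
      have h1 := hsub.lim_le_div hbdd hn.ne'
      rw [le_div_iff₀ hn'] at h1
      rw [← Real.exp_nat_mul, ← Real.log_le_iff_le_exp (hpos' n)]
      linarith

theorem SumIndecomposable.exists_hasGrowth {b : ℕ} (hb : 2 ≤ b) {β : Perm b}
    (h : SumIndecomposable β) :
    ∃ g : ℝ, 1 ≤ g ∧ HasGrowth (avSet β) g ∧ ∀ n, ((avSet β n).ncard : ℝ) ≤ g ^ n := by
  obtain ⟨c, hle⟩ := exists_ncard_avSet_le_pow hb β
  exact SumClosed.exists_hasGrowth h.sumClosed_avSet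
    (fun n => (Set.ncard_pos (Set.toFinite _)).2 ⟨1, h.one_mem_avSet hb n⟩) hle

theorem pattern_skewSum_one_iff {b n : ℕ} {β : Perm b} {π : Perm n} :
    Pattern (skewSum one1 β) π ↔ ∃ (p : Fin n) (f : Fin b → Fin n), StrictMono f ∧
      (∀ i j, β i < β j ↔ π (f i) < π (f j)) ∧ ∀ i, p < f i ∧ π (f i) < π p := by
  have h0 : ((skewSum one1 β (finSumFinEquiv (Sum.inl 0)) : Fin (1 + b)) : ℕ) = b := by
    simp [skewSum]
  have h1 : ∀ i, ((skewSum one1 β (finSumFinEquiv (Sum.inr i)) : Fin (1 + b)) : ℕ) = β i := by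
    intro i
    simp [skewSum]
  constructor
  · rintro ⟨f, hf⟩
    refine ⟨f (finSumFinEquiv (Sum.inl 0)), fun i => f (finSumFinEquiv (Sum.inr i)),
      fun i j hij => f.lt_iff_lt.2 (finSumFinEquiv_inr_lt_inr.2 hij), fun i j => ?_,
      fun i => ⟨f.lt_iff_lt.2 (finSumFinEquiv_inl_lt_inr _ _), ?_⟩⟩
    · rw [← hf, Fin.lt_def, Fin.lt_def, h1, h1]
    · rw [← hf, Fin.lt_def, h0, h1]
      exact (β i).2
  · rintro ⟨p, f, hf, hβ, hp⟩
    refine pattern_of_strictMono (fun x => Sum.elim (fun _ => p) f (finSumFinEquiv.symm x)) ?_ ?_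
    · intro x y
      obtain ⟨x, rfl⟩ := finSumFinEquiv.surjective x
      obtain ⟨y, rfl⟩ := finSumFinEquiv.surjective y
      simp only [Equiv.symm_apply_apply]
      rcases x with x | x <;> rcases y with y | y <;> intro hxy
      · rw [Subsingleton.elim x y] at hxy
        exact absurd hxy (lt_irrefl _)
      · exact (hp y).1
      · exact absurd hxy (finSumFinEquiv_inl_lt_inr y x).not_gt
      · exact hf (finSumFinEquiv_inr_lt_inr.1 hxy)
    · intro x y
      obtain ⟨x, rfl⟩ := finSumFinEquiv.surjective x
      obtain ⟨y, rfl⟩ := finSumFinEquiv.surjective y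
      simp only [Equiv.symm_apply_apply]
      rcases x with x | x <;> rcases y with y | y
      · rw [Subsingleton.elim x y]
        simp
      · rw [Subsingleton.elim x 0, Fin.lt_def, h0, h1]
        exact iff_of_false (not_lt.2 (β y).2.le) (hp y).2.not_gt
      · rw [Subsingleton.elim y 0, Fin.lt_def, h0, h1]
        exact iff_of_true (β x).2 (hp x).2
      · rw [Fin.lt_def, h1, h1, ← Fin.lt_def]
        exact hβ x y

theorem sumIndecomposable_skewSum_one {b : ℕ} (β : Perm b) :
    SumIndecomposable (skewSum one1 β) := by
  intro p hp hpb h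
  have h0 := h (finSumFinEquiv (Sum.inl 0))
  simp [skewSum] at h0
  omega

/-- The equivalence merging two increasing sequences so that the first occupies `s`. -/
def shuffle {d a : ℕ} (s : {s : Finset (Fin (d + a)) // s.card = d}) :
    Fin d ⊕ Fin a ≃ Fin (d + a) :=
  finSumEquivOfFinset s.2
    (by rw [Finset.card_compl, s.2, Fintype.card_fin, Nat.add_sub_cancel_left])

theorem shuffle_inl_lt_inl {d a : ℕ} (s : {s : Finset (Fin (d + a)) // s.card = d}) {i j : Fin d} :
    shuffle s (Sum.inl i) < shuffle s (Sum.inl j) ↔ i < j := by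
  simp [shuffle]

theorem shuffle_inr_lt_inr {d a : ℕ} (s : {s : Finset (Fin (d + a)) // s.card = d}) {i j : Fin a} :
    shuffle s (Sum.inr i) < shuffle s (Sum.inr j) ↔ i < j := by
  simp [shuffle]

theorem shuffle_mem_iff {d a : ℕ} (s : {s : Finset (Fin (d + a)) // s.card = d})
    (q : Fin d ⊕ Fin a) : shuffle s q ∈ s.1 ↔ q.isLeft := by
  rcases q with i | i
  · simp [shuffle]
  · simpa [shuffle] using Finset.mem_compl.1 (Finset.orderEmbOfFin_mem s.1ᶜ _ i)

/-- The positions of the entries after appending one step to a staircase: the old entries come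
first, followed by a merge of the two new cells. -/
def stairPos (M : ℕ) {d a : ℕ} (e : Fin d ⊕ Fin a ≃ Fin (d + a)) :
    Fin (M + a) ⊕ (Fin d ⊕ Fin a) ≃ Fin (M + (d + a) + a) :=
  (((Equiv.refl _).sumCongr e).trans finSumFinEquiv).trans (finCongr (by omega))

/-- The values of the entries after appending one step to a staircase: the first new cell is
merged with the top `a` old values, and the second new cell lies above everything else. -/
def stairVal (M : ℕ) {d a : ℕ} (e : Fin d ⊕ Fin a ≃ Fin (d + a)) :
    Fin (M + a) ⊕ (Fin d ⊕ Fin a) ≃ Fin (M + (d + a) + a) :=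
  (finSumFinEquiv.symm.sumCongr (Equiv.refl _)).trans <| (Equiv.sumAssoc _ _ _).trans <|
    ((Equiv.refl _).sumCongr <| (Equiv.sumAssoc _ _ _).symm.trans <|
      (((Equiv.sumComm _ _).trans e).sumCongr (Equiv.refl _))).trans <|
    (Equiv.sumAssoc _ _ _).symm.trans <|
      (finSumFinEquiv.sumCongr (Equiv.refl _)).trans finSumFinEquiv

section stair

variable {M d a : ℕ} (e : Fin d ⊕ Fin a ≃ Fin (d + a))

@[simp]
theorem stairPos_inl (p : Fin (M + a)) : (stairPos M e (Sum.inl p) : ℕ) = p := by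
  simp [stairPos]

@[simp]
theorem stairPos_inr (q : Fin d ⊕ Fin a) : (stairPos M e (Sum.inr q) : ℕ) = M + a + e q := by
  simp [stairPos]

@[simp]
theorem stairVal_inl_castAdd (v : Fin M) :
    (stairVal M e (Sum.inl (Fin.castAdd a v)) : ℕ) = v := by
  simp [stairVal]

@[simp]
theorem stairVal_inl_natAdd (j : Fin a) :
    (stairVal M e (Sum.inl (Fin.natAdd M j)) : ℕ) = M + e (Sum.inr j) := by
  simp [stairVal]

@[simp]
theorem stairVal_inr_inl (r : Fin d) :
    (stairVal M e (Sum.inr (Sum.inl r)) : ℕ) = M + e (Sum.inl r) := by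
  simp [stairVal]

@[simp]
theorem stairVal_inr_inr (r : Fin a) :
    (stairVal M e (Sum.inr (Sum.inr r)) : ℕ) = M + (d + a) + r := by
  simp [stairVal]

end stair

/-- The permutations of length `M + a` avoiding `1 ⊖ β` in which the `a` largest values appear
in increasing order. -/
def topIncreasing {b : ℕ} (β : Perm b) (a M : ℕ) : Set (Perm (M + a)) :=
  {σ | ¬ Pattern (skewSum one1 β) σ ∧ ∀ u v, M ≤ (σ u : ℕ) → σ u < σ v → u < v}

/-- The permutation obtained from `σ` by appending one step of a staircase: a copy of `δ` merged
by values with the top `a` entries of `σ`, and an increasing sequence of length `a` merged by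
positions with the copy of `δ`. -/
def appendStair {M d a : ℕ} (σ : Perm (M + a)) (δ : Perm d)
    (V W : {s : Finset (Fin (d + a)) // s.card = d}) : Perm (M + (d + a) + a) :=
  (stairPos M (shuffle V)).symm.trans
    ((σ.sumCongr (δ.sumCongr (Equiv.refl _))).trans (stairVal M (shuffle W)))

theorem appendStair_stairPos {M d a : ℕ} (σ : Perm (M + a)) (δ : Perm d)
    (V W : {s : Finset (Fin (d + a)) // s.card = d}) (q : Fin (M + a) ⊕ (Fin d ⊕ Fin a)) :
    appendStair σ δ V W (stairPos M (shuffle V) q) =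
      stairVal M (shuffle W) (Sum.map σ (Sum.map δ id) q) := by
  rcases q with q | q | q <;> simp [appendStair]

theorem stairVal_inl_lt_inl {M d a : ℕ} (W : {s : Finset (Fin (d + a)) // s.card = d})
    {u v : Fin (M + a)} :
    stairVal M (shuffle W) (Sum.inl u) < stairVal M (shuffle W) (Sum.inl v) ↔ u < v := by
  have key : StrictMono fun u : Fin (M + a) => stairVal M (shuffle W) (Sum.inl u) := by
    intro u v
    refine Fin.addCases (fun i => ?_) (fun i => ?_) u <;>
      refine Fin.addCases (fun j => ?_) (fun j => ?_) v <;> intro h <;>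
      simp only [Fin.lt_def, stairVal_inl_castAdd, stairVal_inl_natAdd, Fin.val_castAdd,
        Fin.val_natAdd] at h ⊢
    · exact h
    · omega
    · omega
    · have := (shuffle_inr_lt_inr W (i := i) (j := j)).2 (by rw [Fin.lt_def]; omega)
      rw [Fin.lt_def] at this
      omega
  exact key.lt_iff_lt

theorem stairVal_inr_inl_lt {M d a : ℕ} (W : {s : Finset (Fin (d + a)) // s.card = d})
    {i j : Fin d} :
    stairVal M (shuffle W) (Sum.inr (Sum.inl i)) < stairVal M (shuffle W) (Sum.inr (Sum.inl j)) ↔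
      i < j := by
  rw [← shuffle_inl_lt_inl W, Fin.lt_def, Fin.lt_def, stairVal_inr_inl, stairVal_inr_inl]
  omega

theorem stairVal_inl_lt_top {M d a : ℕ} (e : Fin d ⊕ Fin a ≃ Fin (d + a)) (u : Fin (M + a)) :
    (stairVal M e (Sum.inl u) : ℕ) < M + (d + a) := by
  refine Fin.addCases (fun i => ?_) (fun i => ?_) u
  · rw [stairVal_inl_castAdd]
    omega
  · rw [stairVal_inl_natAdd]
    omega

theorem stairVal_inr_inl_lt_top {M d a : ℕ} (e : Fin d ⊕ Fin a ≃ Fin (d + a)) (r : Fin d) :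
    (stairVal M e (Sum.inr (Sum.inl r)) : ℕ) < M + (d + a) := by
  rw [stairVal_inr_inl]
  omega

theorem appendStair_mem_topIncreasing {b M d a : ℕ} {β : Perm b} (hβ : SumIndecomposable β)
    {σ : Perm (M + a)} (hσ : σ ∈ topIncreasing β a M) {δ : Perm d} (hδ : δ ∈ avSet β d)
    (V W : {s : Finset (Fin (d + a)) // s.card = d}) :
    appendStair σ δ V W ∈ topIncreasing β a (M + (d + a)) := by
  constructor
  · rw [pattern_skewSum_one_iff]
    rintro ⟨p, f, hf, hfβ, hp⟩
    obtain ⟨z, rfl⟩ := (stairPos M (shuffle V)).surjective p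
    obtain ⟨q, rfl⟩ : ∃ q, f = fun i => stairPos M (shuffle V) (q i) :=
      ⟨fun i => (stairPos M (shuffle V)).symm (f i), by simp⟩
    simp only [appendStair_stairPos] at hfβ hp
    have contra : ∀ r : Fin b → Fin d, ¬ ∀ i, q i = Sum.inr (Sum.inl (r i)) := by
      intro r hr
      simp only [hr, Sum.map_inr, Sum.map_inl, stairVal_inr_inl_lt] at hfβ
      refine hδ (pattern_of_strictMono r (fun i j hij => ?_) hfβ)
      have := hf hij
      simp only [hr] at this
      rw [← shuffle_inl_lt_inl V]
      simp only [Fin.lt_def, stairPos_inr] at this ⊢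
      omega
    rcases z with w | z
    · have hI : ∀ i r, q i ≠ Sum.inr (Sum.inr r) := by
        intro i r hi
        have h1 := (hp i).2
        rw [hi, Sum.map_inl, Sum.map_inr, Sum.map_inr, Fin.lt_def, stairVal_inr_inr] at h1
        have := stairVal_inl_lt_top (shuffle W) (σ w)
        omega
      rcases hβ.forall_or_forall_not (S := fun i => (q i).isLeft) (by
        intro i j hi hj
        obtain ⟨u, hu⟩ := Sum.isLeft_iff.1 hi
        obtain ⟨r, hr⟩ := Sum.isRight_iff.1 (Sum.not_isLeft.1 hj)
        obtain r | r := r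
        swap
        · exact absurd hr (hI j r)
        have hpi := hp i
        rw [hu, Sum.map_inl, Sum.map_inl, stairVal_inl_lt_inl, Fin.lt_def, stairPos_inl,
          stairPos_inl, ← Fin.lt_def] at hpi
        have hu' : (σ u : ℕ) < M := by
          by_contra hM
          exact (hσ.2 u w (not_lt.1 hM) hpi.2).not_gt hpi.1
        constructor
        · rw [← hf.lt_iff_lt]
          simp only [hu, hr, Fin.lt_def, stairPos_inl, stairPos_inr]
          omega
        · rw [hfβ, hu, hr, Sum.map_inl, Sum.map_inr, Sum.map_inl, Fin.lt_def,
            show σ u = Fin.castAdd a ⟨σ u, hu'⟩ from rfl, stairVal_inl_castAdd, stairVal_inr_inl]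
          exact hu'.trans_le (Nat.le_add_right _ _)) with hl | hr
      · choose u hu using fun i => Sum.isLeft_iff.1 (hl i)
        refine hσ.1 (pattern_skewSum_one_iff.2 ⟨w, u, fun i j hij => ?_, fun i j => ?_,
          fun i => ?_⟩)
        · have := hf hij
          simpa only [hu, Fin.lt_def, stairPos_inl] using this
        · simpa only [hu, Sum.map_inl, stairVal_inl_lt_inl] using hfβ i j
        · have hpi := hp i
          rwa [hu, Sum.map_inl, Sum.map_inl, stairVal_inl_lt_inl, Fin.lt_def, stairPos_inl,
            stairPos_inl, ← Fin.lt_def] at hpi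
      · have hD : ∀ i, ∃ r, q i = Sum.inr (Sum.inl r) := by
          intro i
          obtain ⟨r | r, h⟩ := Sum.isRight_iff.1 (Sum.not_isLeft.1 (hr i))
          · exact ⟨r, h⟩
          · exact absurd h (hI i r)
        choose r hr using hD
        exact contra r hr
    · have hD : ∀ i, ∃ r, q i = Sum.inr (Sum.inl r) := by
        intro i
        obtain ⟨h1, h2⟩ := hp i
        rcases hq : q i with u | r | r
        · rw [hq, Fin.lt_def, stairPos_inl, stairPos_inr] at h1
          omega
        · exact ⟨r, rfl⟩
        · rw [hq] at h1 h2
          rcases z with z | z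
          · have := stairVal_inr_inl_lt_top (M := M) (shuffle W) (δ z)
            simp only [Sum.map_inr, Sum.map_inl, Fin.lt_def, stairVal_inr_inr] at h2
            omega
          · simp only [Sum.map_inr, Fin.lt_def, stairVal_inr_inr, stairPos_inr, id_eq] at h1 h2
            have := (shuffle_inr_lt_inr V (i := z) (j := r)).1 (by rw [Fin.lt_def]; omega)
            rw [Fin.lt_def] at this
            omega
      choose r hr using hD
      exact contra r hr
  · intro u v hu huv
    have hI : ∀ x, M + (d + a) ≤ (appendStair σ δ V W x : ℕ) →
        ∃ r, x = stairPos M (shuffle V) (Sum.inr (Sum.inr r)) := by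
      intro x hx
      obtain ⟨x, rfl⟩ := (stairPos M (shuffle V)).surjective x
      rw [appendStair_stairPos] at hx
      rcases x with x | x | x
      · exact absurd hx (stairVal_inl_lt_top (shuffle W) (σ x)).not_ge
      · exact absurd hx (stairVal_inr_inl_lt_top (shuffle W) (δ x)).not_ge
      · exact ⟨x, rfl⟩
    obtain ⟨r, rfl⟩ := hI u hu
    obtain ⟨t, rfl⟩ := hI v (hu.trans huv.le)
    rw [appendStair_stairPos, appendStair_stairPos] at huv
    simp only [Sum.map_inr, Fin.lt_def, stairVal_inr_inr, id_eq] at huv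
    have := (shuffle_inr_lt_inr V (i := r) (j := t)).2 (by rw [Fin.lt_def]; omega)
    simp only [Fin.lt_def, stairPos_inr] at this ⊢
    omega

theorem appendStair_injective (M d a : ℕ) :
    Function.Injective fun x : (Perm (M + a) × Perm d) ×
      {s : Finset (Fin (d + a)) // s.card = d} × {s : Finset (Fin (d + a)) // s.card = d} =>
        appendStair x.1.1 x.1.2 x.2.1 x.2.2 := by
  have hV : ∀ (σ : Perm (M + a)) (δ : Perm d) (V W : {s : Finset (Fin (d + a)) // s.card = d})
      (j : Fin (d + a)), j ∈ V.1 ↔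
        ∀ x : Fin (M + (d + a) + a), (x : ℕ) = M + a + j →
          (appendStair σ δ V W x : ℕ) < M + (d + a) := by
    intro σ δ V W j
    obtain ⟨q, rfl⟩ := (shuffle V).surjective j
    have hx : ∀ x : Fin (M + (d + a) + a), (x : ℕ) = M + a + shuffle V q ↔
        x = stairPos M (shuffle V) (Sum.inr q) := fun x => by rw [Fin.ext_iff, stairPos_inr]
    simp only [hx, forall_eq, appendStair_stairPos, shuffle_mem_iff]
    rcases q with r | r
    · simp
    · simp
  have hW : ∀ (σ : Perm (M + a)) (δ : Perm d) (W : {s : Finset (Fin (d + a)) // s.card = d})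
      (j : Fin (d + a)), j ∈ W.1 ↔
        ∃ r, (stairVal M (shuffle W) (Sum.map σ (Sum.map δ id) (Sum.inr (Sum.inl r))) : ℕ) =
          M + j := by
    intro σ δ W j
    obtain ⟨q, rfl⟩ := (shuffle W).surjective j
    simp only [shuffle_mem_iff, Sum.map_inr, Sum.map_inl, stairVal_inr_inl, Nat.add_left_cancel_iff,
      Fin.val_inj, EmbeddingLike.apply_eq_iff_eq]
    rcases q with r | r
    · simpa using δ.surjective r
    · simp
  rintro ⟨⟨σ, δ⟩, V, W⟩ ⟨⟨σ', δ'⟩, V', W'⟩ h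
  dsimp only at h
  obtain rfl : V = V' := Subtype.ext <| Finset.ext fun j => by
    rw [hV σ δ V W, hV σ' δ' V' W', h]
  have hval : ∀ q, stairVal M (shuffle W) (Sum.map σ (Sum.map δ id) q) =
      stairVal M (shuffle W') (Sum.map σ' (Sum.map δ' id) q) := fun q => by
    rw [← appendStair_stairPos σ δ V, h, appendStair_stairPos]
  obtain rfl : W = W' := Subtype.ext <| Finset.ext fun j => by
    rw [hW σ δ, hW σ' δ' W']
    simp only [hval]
  have hmap := fun q => (stairVal M (shuffle W)).injective (hval q)
  obtain rfl : σ = σ' := Equiv.ext fun i => by simpa using hmap (Sum.inl i)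
  obtain rfl : δ = δ' := Equiv.ext fun i => by simpa using hmap (Sum.inr (Sum.inl i))
  rfl

theorem ncard_topIncreasing_mul_le {b : ℕ} {β : Perm b} (hβ : SumIndecomposable β) (M d a : ℕ) :
    (topIncreasing β a M).ncard * ((avSet β d).ncard * (d + a).choose d ^ 2) ≤
      (topIncreasing β a (M + (d + a))).ncard := by
  have hc : (Set.univ : Set {s : Finset (Fin (d + a)) // s.card = d}).ncard =
      (d + a).choose d := by
    rw [Set.ncard_univ, Nat.card_eq_fintype_card, Fintype.card_finset_len, Fintype.card_fin]
  rw [sq, ← hc, ← Set.ncard_prod, ← mul_assoc, ← Set.ncard_prod, ← Set.ncard_prod]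
  exact Set.ncard_le_ncard_of_injOn _
    (fun x hx => appendStair_mem_topIncreasing hβ hx.1.1 hx.1.2 x.2.1 x.2.2)
    (appendStair_injective M d a).injOn (Set.toFinite _)

theorem pow_le_ncard_topIncreasing {b : ℕ} {β : Perm b} (hβ : SumIndecomposable β)
    (hb : 0 < b) (d a k : ℕ) :
    ((avSet β d).ncard * (d + a).choose d ^ 2) ^ k ≤ (topIncreasing β a (k * (d + a))).ncard := by
  induction k with
  | zero =>
    rw [pow_zero, zero_mul]
    refine Nat.succ_le_of_lt ((Set.ncard_pos (Set.toFinite _)).2 ⟨1, fun h => ?_, fun u v _ h => h⟩)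
    exact (sumIndecomposable_skewSum_one β).one_mem_avSet (by omega) _ h
  | succ k ih =>
    rw [pow_succ, Nat.succ_mul]
    exact (Nat.mul_le_mul_right _ ih).trans (ncard_topIncreasing_mul_le hβ _ _ _)

theorem le_of_pow_le_mul_pow {u v K : ℝ} (hv : 0 < v)
    (h : ∀ n : ℕ, u ^ n ≤ K * (n + 1) * v ^ n) : u ≤ v := by
  by_contra! huv
  have hr : 1 < u / v := (one_lt_div hv).2 huv
  have hlim : Tendsto (fun n : ℕ => K * ((n : ℝ) ^ 1 / (u / v) ^ n + (n : ℝ) ^ 0 / (u / v) ^ n))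
      atTop (𝓝 (K * (0 + 0))) :=
    ((tendsto_pow_const_div_const_pow_of_one_lt 1 hr).add
      (tendsto_pow_const_div_const_pow_of_one_lt 0 hr)).const_mul K
  have hge : ∀ n : ℕ, 1 ≤ K * ((n : ℝ) ^ 1 / (u / v) ^ n + (n : ℝ) ^ 0 / (u / v) ^ n) := by
    intro n
    rw [← add_div, ← mul_div_assoc, le_div_iff₀ (by positivity), one_mul, div_pow,
      div_le_iff₀ (by positivity), pow_one, pow_zero]
    exact h n
  have := ge_of_tendsto' hlim hge
  norm_num at this

theorem HasGrowth.exists_mul_pow_le {F : ∀ m, Set (Perm m)} {g t : ℝ} (hF : HasGrowth F g)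
    (hpos : ∀ n, 0 < (F n).ncard) (ht : 0 < t) (htg : t < g) :
    ∃ K : ℝ, 0 < K ∧ ∀ n, K * t ^ n ≤ (F n).ncard := by
  obtain ⟨N, hN⟩ := eventually_atTop.1 (hF.eventually (lt_mem_nhds htg))
  set m : ℝ := max 1 t with hm
  have h1m : 1 ≤ m := le_max_left _ _
  refine ⟨1 / m ^ (N + 1), by positivity, fun n => ?_⟩
  rw [div_mul_eq_mul_div, one_mul, div_le_iff₀ (by positivity)]
  have h1 : (1 : ℝ) ≤ (F n).ncard := by exact_mod_cast hpos n
  by_cases hn : N + 1 ≤ n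
  · have h2 := hN n (by omega)
    have h3 : t ^ n ≤ (F n).ncard := by
      have := pow_le_pow_left₀ ht.le h2.le n
      rwa [growthSeq, Real.rpow_inv_natCast_pow (by positivity) (by omega)] at this
    exact h3.trans (le_mul_of_one_le_right (by positivity) (one_le_pow₀ h1m))
  · calc t ^ n ≤ m ^ n := pow_le_pow_left₀ ht.le (le_max_right _ _) n
      _ ≤ m ^ (N + 1) := pow_le_pow_right₀ h1m (by omega)
      _ ≤ _ := le_mul_of_one_le_left (by positivity) h1

theorem ncard_avSet_mul_choose_sq_le {b : ℕ} (hb : 0 < b) {β : Perm b} (hβ : SumIndecomposable β)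
    {g : ℝ} (hg : 1 ≤ g) (hle : ∀ n, ((avSet (skewSum one1 β) n).ncard : ℝ) ≤ g ^ n) (d a : ℕ) :
    ((avSet β d).ncard : ℝ) * ((d + a).choose d : ℝ) ^ 2 ≤ g ^ (d + a) := by
  refine le_of_pow_le_mul_pow (K := g ^ a) (by positivity) fun k => ?_
  have h1 : (((avSet β d).ncard : ℝ) * ((d + a).choose d : ℝ) ^ 2) ^ k ≤
      (topIncreasing β a (k * (d + a))).ncard := by
    exact_mod_cast pow_le_ncard_topIncreasing hβ hb d a k
  have h2 : ((topIncreasing β a (k * (d + a))).ncard : ℝ) ≤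
      (avSet (skewSum one1 β) (k * (d + a) + a)).ncard := by
    exact_mod_cast Set.ncard_le_ncard
      (show topIncreasing β a (k * (d + a)) ⊆ _ from fun σ hσ => hσ.1) (Set.toFinite _)
  calc _ ≤ g ^ (k * (d + a) + a) := h1.trans (h2.trans (hle _))
    _ = g ^ a * 1 * (g ^ (d + a)) ^ k := by rw [← pow_mul, mul_one, ← pow_add]; congr 1; ring
    _ ≤ g ^ a * (k + 1) * (g ^ (d + a)) ^ k := by
      gcongr
      linarith [(Nat.cast_nonneg k : (0 : ℝ) ≤ k)]

theorem one_add_sqrt_le {A : ℕ → ℝ} {g' t K : ℝ} (hK : 0 < K) (hg' : 0 < g')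
    (hA : ∀ d, K * (t ^ 2) ^ d ≤ A d)
    (h : ∀ d a, A d * ((d + a).choose d : ℝ) ^ 2 ≤ g' ^ (d + a)) : 1 + t ≤ √g' := by
  refine le_of_pow_le_mul_pow (K := 1 / √K) (by positivity) fun m => ?_
  have hterm : ∀ d ∈ Finset.range (m + 1), t ^ d * 1 ^ (m - d) * (m.choose d : ℝ) ≤
      1 / √K * √g' ^ m := by
    intro d hd
    obtain ⟨a, rfl⟩ := Nat.exists_eq_add_of_le (Nat.lt_succ_iff.1 (Finset.mem_range.1 hd))
    rw [one_pow, mul_one, div_mul_eq_mul_div, one_mul, le_div_iff₀ (by positivity)]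
    refine le_of_sq_le_sq ?_ (by positivity)
    calc (t ^ d * ((d + a).choose d : ℝ) * √K) ^ 2
        = K * (t ^ 2) ^ d * ((d + a).choose d : ℝ) ^ 2 := by
          rw [mul_pow, Real.sq_sqrt hK.le]
          ring
      _ ≤ A d * ((d + a).choose d : ℝ) ^ 2 := by gcongr; exact hA d
      _ ≤ g' ^ (d + a) := h d a
      _ = (√g' ^ (d + a)) ^ 2 := by rw [← pow_mul, mul_comm, pow_mul, Real.sq_sqrt hg'.le]
  rw [add_comm, add_pow]
  refine (Finset.sum_le_card_nsmul _ _ _ hterm).trans_eq ?_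
  rw [Finset.card_range, nsmul_eq_mul]
  push_cast
  ring

theorem hasGrowth_avSet_of_length_one (β : Perm 1) : HasGrowth (avSet β) 0 := by
  refine tendsto_const_nhds.congr' ?_
  filter_upwards [eventually_ge_atTop 1] with n hn
  have : avSet β n = ∅ := Set.eq_empty_of_forall_notMem fun π hπ =>
    hπ (pattern_of_strictMono (fun _ => ⟨0, hn⟩) (Subsingleton.strictMono _) fun i j => by
      simp [Subsingleton.elim i j])
  rw [growthSeq, this, Set.ncard_empty, Nat.cast_zero, Real.zero_rpow]
  positivity

theorem one_add_sqrt_sq_le {b : ℕ} (hb : 2 ≤ b) {β : Perm b} (hβ : SumIndecomposable β)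
    {g g' : ℝ} (hg : HasGrowth (avSet β) g) (hg' : 1 ≤ g')
    (hle : ∀ n, ((avSet (skewSum one1 β) n).ncard : ℝ) ≤ g' ^ n) : (1 + √g) ^ 2 ≤ g' := by
  rw [← Real.le_sqrt (by positivity) (by positivity), ← le_sub_iff_add_le']
  refine le_of_forall_lt_imp_le_of_dense fun t ht => ?_
  rw [le_sub_iff_add_le']
  obtain ht0 | ht0 := le_or_gt t 0
  · have := Real.one_le_sqrt.2 hg'
    linarith
  obtain ⟨K, hK, hKle⟩ := hg.exists_mul_pow_le
    (fun n => (Set.ncard_pos (Set.toFinite _)).2 ⟨1, hβ.one_mem_avSet hb n⟩) (sq_pos_of_pos ht0)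
    ((Real.lt_sqrt ht0.le).1 ht)
  exact one_add_sqrt_le hK (by positivity) hKle
    (ncard_avSet_mul_choose_sq_le (by omega) hβ hg' hle)

/-- If `β` is a nonempty sum indecomposable permutation, then `Av(β)` and
`Av(1 ⊖ β)` have finite proper growth rates and `gr(Av(1 ⊖ β)) ≥ (1 + √gr(Av(β)))²`. -/
theorem bona_skew_one_growth_ge {b : ℕ} (hb : 0 < b) (β : Perm b)
    (hind : ∀ p, 0 < p → p < b → ¬ (∀ i : Fin b, (i : ℕ) < p ↔ (β i : ℕ) < p)) :
    ∃ g g' : ℝ, HasGrowth (avSet β) g ∧ HasGrowth (avSet (skewSum one1 β)) g' ∧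
      (1 + Real.sqrt g) ^ 2 ≤ g' := by
  obtain ⟨g', hg'1, hg', hle⟩ :=
    (sumIndecomposable_skewSum_one β).exists_hasGrowth (by omega)
  obtain rfl | hb2 := (show 1 ≤ b from hb).eq_or_lt
  · exact ⟨0, g', hasGrowth_avSet_of_length_one β, hg', by simpa using hg'1⟩
  · obtain ⟨g, -, hg, -⟩ := SumIndecomposable.exists_hasGrowth hb2 hind
    exact ⟨g, g', hg, hg', one_add_sqrt_sq_le hb2 hind hg hg'1 hle⟩
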